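/- (Cohen-type identity) For every nonzero q ∈ ℤ[i] and every x ∈ ℤ[i]: Σ_{r ∈ 𝔸_{q̄}} τ_q(x + r) = μ(q) τ_q(x). -/

import Mathlib

open Complex GaussianInt MeasureTheory
open scoped Real ENNReal

noncomputable section
attribute [local instance] Classical.propDecidable

/-- The real inner product on `ℂ ≅ ℝ²`: `⟨z, w⟩ = Re z · Re w + Im z · Im w`. -/
def cip (z w : ℂ) : ℝ := z.re * w.re + z.im * w.im

/-- `e(t) = exp(2πit)`. -/
def e2 (t : ℝ) : ℂ := Complex.exp (2 * Real.pi * Complex.I * t)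

/-- The fundamental box `B_q` of residues modulo `q`:
`B_q = {r : 0 ≤ ⟨r,q⟩ < N(q), 0 ≤ ⟨r,iq⟩ < N(q)}`. -/
def Bq (q : GaussianInt) : Set GaussianInt :=
  {r | 0 ≤ cip (toComplex r) (toComplex q) ∧
       cip (toComplex r) (toComplex q) < Complex.normSq (toComplex q) ∧
       0 ≤ cip (toComplex r) (Complex.I * toComplex q) ∧
       cip (toComplex r) (Complex.I * toComplex q) < Complex.normSq (toComplex q)}

/-- `𝔸_q`, the reduced residues in `B_q` (gcd with `q` a unit). -/
def Aq (q : GaussianInt) : Set GaussianInt :=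
  {r | r ∈ Bq q ∧ IsUnit (EuclideanDomain.gcd r q)}

/-- The Euler totient on `ℤ[i]`: `φ(q) = |𝔸_q|`. -/
def gphi (q : GaussianInt) : ℕ := Nat.card (Aq q)

/-- The Gaussian Ramanujan sum `τ_q(x) = Σ_{n ∈ 𝔸_q} e(⟨x, n/q⟩)`. -/
def gtau (q x : GaussianInt) : ℂ :=
  ∑' n : Aq q, e2 (cip (toComplex x) (toComplex (n : GaussianInt) / toComplex q))

/-- The Möbius function on `ℤ[i]`: `(-1)^k` on squarefree numbers with `k`
pairwise non-associate prime factors (so `1` on units), and `0` otherwise. -/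
def gmu (n : GaussianInt) : ℤ :=
  if n ≠ 0 ∧ Squarefree n then (-1) ^ (UniqueFactorizationMonoid.factors n).card else 0

/-- The von Mangoldt function on `ℤ[i]`: `Λ(n) = log N(ρ)` if `n` is a unit times
`ρ^k` for a Gaussian prime `ρ` and `k ≥ 1`, and `0` otherwise. -/
def gvm (n : GaussianInt) : ℝ :=
  if h : ∃ ρ : GaussianInt, Irreducible ρ ∧
      ∃ k : ℕ, 1 ≤ k ∧ ∃ u : GaussianInt, IsUnit u ∧ n = u * ρ ^ k
  then Real.log (Complex.normSq (toComplex h.choose)) else 0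

/-- `ω ⊆ 𝕋 = ℝ/2πℤ` is an interval (arc) of length `l`. -/
def IsArc (ω : Set Real.Angle) (l : ℝ) : Prop :=
  ∃ a : ℝ, ω = (fun θ : ℝ => (θ : Real.Angle)) '' Set.Ico a (a + l)

/-- `arg z ∈ ω`, as a condition in `𝕋`. -/
def argIn (z : ℂ) (ω : Set Real.Angle) : Prop := (↑(Complex.arg z) : Real.Angle) ∈ ω

/-- The normalized sector average kernel `M_N^ω`. -/
def Msec (ω : Set Real.Angle) (l : ℝ) (N : ℕ) (n : GaussianInt) : ℝ :=
  if Zsqrtd.norm n < (N : ℤ) ∧ argIn (toComplex n) ω then 2 * Real.pi / (l * N) else 0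

/-- The weighted sector average kernel `A_N^ω` (with von Mangoldt weights). -/
def Asec (ω : Set Real.Angle) (l : ℝ) (N : ℕ) (n : GaussianInt) : ℂ :=
  if Zsqrtd.norm n < (N : ℤ) ∧ argIn (toComplex n) ω then
    ((2 * Real.pi / (l * N) : ℝ) : ℂ) * (gvm n : ℂ) else 0

/-- The canonical representative of a nonzero associate class in `ℤ[i]`. -/
def IsCanon (z : GaussianInt) : Prop := 0 < z.re ∧ 0 ≤ z.im

/-- `Φ(a, q) = τ_q(a)/φ(q)`. -/
def Phi (a q : GaussianInt) : ℂ := gtau q a / (gphi q : ℂ)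

/-- `Â_N^ω(α)`: the Fourier transform of the weighted sector average. -/
def Ahat (ω : Set Real.Angle) (l : ℝ) (N : ℕ) (α : ℂ) : ℂ :=
  ((2 * Real.pi / (l * N) : ℝ) : ℂ) *
    ∑' n : {m : GaussianInt // Zsqrtd.norm m < (N : ℤ) ∧ argIn (toComplex m) ω},
      (gvm (n : GaussianInt) : ℂ) * e2 (cip (toComplex (n : GaussianInt)) α)

/-- `M̂_N^ω(β)`: the Fourier transform of the sector average. -/
def Mhat (ω : Set Real.Angle) (l : ℝ) (N : ℕ) (β : ℂ) : ℂ :=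
  ((2 * Real.pi / (l * N) : ℝ) : ℂ) *
    ∑' n : {m : GaussianInt // Zsqrtd.norm m < (N : ℤ) ∧ argIn (toComplex m) ω},
      e2 (cip (toComplex (n : GaussianInt)) β)

/-- The tensor Fejér-type bump `η(ξ₁+iξ₂) = (1-|ξ₁|)₊ (1-|ξ₂|)₊`. -/
def eta (ξ : ℂ) : ℝ := max 0 (1 - |ξ.re|) * max 0 (1 - |ξ.im|)

/-- `Δ_s(ξ) = η(16^s ξ)`. -/
def Delta (s : ℕ) (ξ : ℂ) : ℝ := eta ((16 : ℂ) ^ s * ξ)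

/-- `Δ̌_{q₀}(n) = ∫_{[-1/2,1/2)²} Δ_{q₀}(ξ) e(⟨n, ξ⟩) dξ`. -/
def DeltaCheck (q₀ : ℕ) (n : GaussianInt) : ℂ :=
  ∫ p in (Set.Ico (-(1:ℝ)/2) (1/2)) ×ˢ (Set.Ico (-(1:ℝ)/2) (1/2)),
    ((Delta q₀ ((p.1 : ℂ) + (p.2 : ℂ) * Complex.I) : ℝ) : ℂ) *
      e2 (cip (toComplex n) ((p.1 : ℂ) + (p.2 : ℂ) * Complex.I))

/-- The Low part `Lo_{Q,N}^ω` with `Q = 2^{q₀}`. -/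
def Lo (ω : Set Real.Angle) (l : ℝ) (N : ℕ) (q₀ : ℕ) (x : GaussianInt) : ℂ :=
  (∑' y : GaussianInt, ((Msec ω l N y : ℝ) : ℂ) * DeltaCheck q₀ (x - y)) *
    ∑' q : {q : GaussianInt // IsCanon q ∧ (Zsqrtd.norm q : ℝ) < 2 ^ q₀},
      ∑' a : Aq (q : GaussianInt),
        Phi (a : GaussianInt) (star (q : GaussianInt)) *
          e2 (cip (toComplex x) (toComplex (a : GaussianInt) / toComplex (q : GaussianInt)))

/-- Distance from `β ∈ ℂ` to the nearest Gaussian integer. -/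
def distZi (β : ℂ) : ℝ := Metric.infDist β (Set.range fun n : GaussianInt => toComplex n)

/-- `q` is `Q`-smooth: squarefree with all prime factors of norm at most `Q`. -/
def QSmooth (Q : ℝ) (q : GaussianInt) : Prop :=
  Squarefree q ∧ ∀ ρ : GaussianInt, Irreducible ρ → ρ ∣ q → (Zsqrtd.norm ρ : ℝ) ≤ Q


section GaussianSums

lemma e2_add (s t : ℝ) : e2 (s + t) = e2 s * e2 t := by
  simp only [e2, ← Complex.exp_add]
  push_cast
  ring_nf

lemma e2_eq_one_iff (t : ℝ) : e2 t = 1 ↔ ∃ n : ℤ, t = n := by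
  rw [e2, Complex.exp_eq_one_iff]
  refine exists_congr fun n => ?_
  rw [show (2 * (Real.pi : ℂ) * Complex.I * t) = t * (2 * Real.pi * Complex.I) by ring,
    mul_left_inj' Complex.two_pi_I_ne_zero]
  exact_mod_cast Iff.rfl

/-- The additive character `y ↦ e(Re (y / q))` of `ℤ[i]`. -/
def gchar (q y : GaussianInt) : ℂ := e2 (toComplex y / toComplex q).re

lemma gchar_add (q y z : GaussianInt) : gchar q (y + z) = gchar q y * gchar q z := by
  simp only [gchar, toComplex_add, add_div, Complex.add_re, e2_add]

lemma gchar_zero (q : GaussianInt) : gchar q 0 = 1 := by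
  simp [gchar, e2]

lemma gchar_mul_left {c : GaussianInt} (hc : c ≠ 0) (q y : GaussianInt) :
    gchar (c * q) (c * y) = gchar q y := by
  have : toComplex c ≠ 0 := by simpa using hc
  rw [gchar, gchar, toComplex_mul, toComplex_mul, mul_div_mul_left _ _ this]

lemma gchar_one (y : GaussianInt) : gchar 1 y = 1 := by
  rw [gchar, e2_eq_one_iff]
  exact ⟨y.re, by simp⟩

lemma gchar_eq_one_of_dvd {q y : GaussianInt} (hq : q ≠ 0) (h : q ∣ y) : gchar q y = 1 := by
  obtain ⟨z, rfl⟩ := h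
  simpa [gchar_one] using gchar_mul_left hq 1 z

lemma gchar_eq_of_dvd_sub {q y z : GaussianInt} (hq : q ≠ 0) (h : q ∣ y - z) :
    gchar q y = gchar q z := by
  rw [← sub_add_cancel y z, gchar_add, gchar_eq_one_of_dvd hq h, one_mul]

/-- The character `gchar q` is primitive modulo `q`. -/
lemma dvd_of_forall_gchar_mul_eq_one {q y : GaussianInt} (hq : q ≠ 0)
    (h : ∀ t, gchar q (y * t) = 1) : q ∣ y := by
  have hq' : toComplex q ≠ 0 := by simpa using hq
  obtain ⟨a, ha⟩ := (e2_eq_one_iff _).1 (h 1)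
  obtain ⟨b, hb⟩ := (e2_eq_one_iff _).1 (h ⟨0, -1⟩)
  have hI : toComplex ⟨0, -1⟩ = -Complex.I := by simp [toComplex_def']
  refine ⟨⟨a, b⟩, toComplex_injective ?_⟩
  rw [toComplex_mul, mul_comm, ← div_eq_iff hq']
  apply Complex.ext
  · simpa using ha
  · rw [toComplex_mul, hI, mul_div_right_comm] at hb
    simpa using hb

/-- The residue ring `ℤ[i] / (q)`. -/
abbrev GResidue (q : GaussianInt) : Type := GaussianInt ⧸ Ideal.span {q}

/-- The residue class of `y` modulo `q`. -/
abbrev gmk (q : GaussianInt) : GaussianInt →+* GResidue q := Ideal.Quotient.mk (Ideal.span {q})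

/-- A representative of a residue class modulo `q`. -/
def gout (q : GaussianInt) (a : GResidue q) : GaussianInt := Quotient.out a

@[simp]
lemma gmk_gout {q : GaussianInt} (a : GResidue q) : gmk q (gout q a) = a :=
  Ideal.Quotient.mk_out a

lemma gmk_eq_iff {q y z : GaussianInt} : gmk q y = gmk q z ↔ q ∣ y - z := by
  rw [Ideal.Quotient.eq, Ideal.mem_span_singleton]

lemma gmk_surjective (q : GaussianInt) : Function.Surjective (gmk q) :=
  Ideal.Quotient.mk_surjective

lemma isUnit_gmk_iff {q y : GaussianInt} : IsUnit (gmk q y) ↔ IsCoprime y q := by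
  rw [isUnit_iff_exists_inv]
  constructor
  · rintro ⟨b, hb⟩
    obtain ⟨z, rfl⟩ := gmk_surjective q b
    rw [← map_mul, ← map_one (gmk q), gmk_eq_iff] at hb
    obtain ⟨c, hc⟩ := hb
    exact ⟨z, -c, by linear_combination hc⟩
  · rintro ⟨a, b, hab⟩
    refine ⟨gmk q a, ?_⟩
    rw [← map_mul, ← map_one (gmk q), gmk_eq_iff]
    exact ⟨-b, by linear_combination hab⟩

lemma cip_self_eq (r q : GaussianInt) :
    cip (toComplex r) (toComplex q) = ((r * star q).re : ℤ) := by
  simp [cip]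

lemma cip_I_mul_eq (r q : GaussianInt) :
    cip (toComplex r) (Complex.I * toComplex q) = ((r * star q).im : ℤ) := by
  simp [cip]

lemma mem_Bq_iff {q r : GaussianInt} :
    r ∈ Bq q ↔ 0 ≤ (r * star q).re ∧ (r * star q).re < q.norm ∧
      0 ≤ (r * star q).im ∧ (r * star q).im < q.norm := by
  rw [Bq, Set.mem_ofPred_eq, cip_self_eq, cip_I_mul_eq, ← intCast_real_norm]
  norm_cast

lemma Bq_finite {q : GaussianInt} (hq : q ≠ 0) : (Bq q).Finite := by
  have hs : star q ≠ 0 := star_ne_zero.2 hq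
  refine Set.Finite.of_injOn (f := fun r => ((r * star q).re, (r * star q).im))
    (t := Set.Ico 0 q.norm ×ˢ Set.Ico 0 q.norm) ?_ ?_
    ((Set.finite_Ico _ _).prod (Set.finite_Ico _ _))
  · intro r hr
    rw [mem_Bq_iff] at hr
    exact ⟨⟨hr.1, hr.2.1⟩, hr.2.2.1, hr.2.2.2⟩
  · intro r _ s _ h
    simp only [Prod.mk.injEq] at h
    exact mul_right_cancel₀ hs (Zsqrtd.ext h.1 h.2)

lemma exists_mem_Bq_dvd_sub {q : GaussianInt} (hq : q ≠ 0) (y : GaussianInt) :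
    ∃ r ∈ Bq q, q ∣ y - r := by
  have hN : 0 < q.norm := GaussianInt.norm_pos.2 hq
  set c : GaussianInt := ⟨(y * star q).re / q.norm, (y * star q).im / q.norm⟩ with hc
  have key : (y - q * c) * star q = y * star q - (q.norm : GaussianInt) * c := by
    rw [Zsqrtd.norm_eq_mul_conj]; ring
  have hre : ((y - q * c) * star q).re = (y * star q).re % q.norm := by
    rw [key, Int.emod_def]; simp [hc]
  have him : ((y - q * c) * star q).im = (y * star q).im % q.norm := by
    rw [key, Int.emod_def]; simp [hc]
  refine ⟨y - q * c, ?_, c, by ring⟩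
  rw [mem_Bq_iff, hre, him]
  exact ⟨Int.emod_nonneg _ hN.ne', Int.emod_lt_of_pos _ hN,
    Int.emod_nonneg _ hN.ne', Int.emod_lt_of_pos _ hN⟩

lemma eq_of_mem_Bq_of_dvd_sub {q r s : GaussianInt} (hq : q ≠ 0) (hr : r ∈ Bq q)
    (hs : s ∈ Bq q) (h : q ∣ r - s) : r = s := by
  have hN : 0 < q.norm := GaussianInt.norm_pos.2 hq
  rw [mem_Bq_iff] at hr hs
  obtain ⟨c, hc⟩ := h
  have key : r * star q = s * star q + (q.norm : GaussianInt) * c := by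
    rw [Zsqrtd.norm_eq_mul_conj]; linear_combination star q * hc
  have hre : (r * star q).re = (s * star q).re + q.norm * c.re := by rw [key]; simp
  have him : (r * star q).im = (s * star q).im + q.norm * c.im := by rw [key]; simp
  refine mul_right_cancel₀ (star_ne_zero.2 hq) (Zsqrtd.ext ?_ ?_)
  · rw [← Int.emod_eq_of_lt hr.1 hr.2.1, hre, Int.add_mul_emod_self_left,
      Int.emod_eq_of_lt hs.1 hs.2.1]
  · rw [← Int.emod_eq_of_lt hr.2.2.1 hr.2.2.2, him, Int.add_mul_emod_self_left,
      Int.emod_eq_of_lt hs.2.2.1 hs.2.2.2]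

lemma finite_gResidue {q : GaussianInt} (hq : q ≠ 0) : Finite (GResidue q) := by
  have := (Bq_finite hq).to_subtype
  refine Finite.of_surjective (fun r : Bq q => gmk q r) fun a => ?_
  obtain ⟨y, rfl⟩ := gmk_surjective q a
  obtain ⟨r, hr, h⟩ := exists_mem_Bq_dvd_sub hq y
  exact ⟨⟨r, hr⟩, (gmk_eq_iff.2 h).symm⟩

lemma mem_Aq_iff {q r : GaussianInt} : r ∈ Aq q ↔ r ∈ Bq q ∧ IsCoprime r q := by
  rw [Aq, Set.mem_ofPred_eq, EuclideanDomain.gcd_isUnit_iff]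

/-- The elements of `𝔸_{q̄}`, conjugated, represent the invertible residue classes modulo `q`. -/
def AqStarEquivUnits {q : GaussianInt} (hq : q ≠ 0) :
    Aq (star q) ≃ {a : GResidue q // IsUnit a} :=
  have hdvd {y z : GaussianInt} : q ∣ star y - star z ↔ star q ∣ y - z := by
    simpa using (map_dvd_iff (starRingAut : GaussianInt ≃+* GaussianInt)
      (a := q) (b := star y - star z)).symm
  have hcop {y : GaussianInt} (h : IsCoprime y (star q)) : IsCoprime (star y) q := by
    simpa using h.map (starRingAut : GaussianInt ≃+* GaussianInt).toRingHom
  have hcop' {y : GaussianInt} (h : IsCoprime (star y) q) : IsCoprime y (star q) := by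
    simpa using h.map (starRingAut : GaussianInt ≃+* GaussianInt).toRingHom
  Equiv.ofBijective (fun r => ⟨gmk q (star r.1), isUnit_gmk_iff.2 (hcop (mem_Aq_iff.1 r.2).2)⟩) <|
    by
    constructor
    · intro r s h
      exact Subtype.ext (eq_of_mem_Bq_of_dvd_sub (star_ne_zero.2 hq) r.2.1 s.2.1
        (hdvd.1 (gmk_eq_iff.1 (congrArg Subtype.val h))))
    · rintro ⟨a, ha⟩
      obtain ⟨y, rfl⟩ := gmk_surjective q a
      obtain ⟨r, hr, h⟩ := exists_mem_Bq_dvd_sub (star_ne_zero.2 hq) (star y)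
      have h' : gmk q y = gmk q (star r) := gmk_eq_iff.2 (by simpa using hdvd.2 h)
      refine ⟨⟨r, mem_Aq_iff.2 ⟨hr, hcop' ?_⟩⟩, Subtype.ext h'.symm⟩
      rwa [← isUnit_gmk_iff, ← h']

/-- The function on `ℤ[i] / (q)` induced by `gchar q`. -/
def residueChar (q : GaussianInt) (a : GResidue q) : ℂ := gchar q (gout q a)

lemma residueChar_gmk {q : GaussianInt} (hq : q ≠ 0) (y : GaussianInt) :
    residueChar q (gmk q y) = gchar q y :=
  gchar_eq_of_dvd_sub hq (gmk_eq_iff.1 (gmk_gout _))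

lemma residueChar_add {q : GaussianInt} (hq : q ≠ 0) (a b : GResidue q) :
    residueChar q (a + b) = residueChar q a * residueChar q b := by
  obtain ⟨y, rfl⟩ := gmk_surjective q a
  obtain ⟨z, rfl⟩ := gmk_surjective q b
  rw [← map_add, residueChar_gmk hq, residueChar_gmk hq, residueChar_gmk hq, gchar_add]

lemma gtau_eq_tsum_gchar (q x : GaussianInt) :
    gtau q x = ∑' n : Aq q, gchar q (star x * n) := by
  refine tsum_congr fun n => ?_
  rw [gchar, toComplex_mul, toComplex_star, mul_div_assoc]
  simp [cip]

/-- The sum of `residueChar q` over the invertible residue classes. -/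
def unitSum (q : GaussianInt) : ℂ := ∑' a : {a : GResidue q // IsUnit a}, residueChar q a

lemma tsum_gchar_star_mul {q n : GaussianInt} (hq : q ≠ 0) (hn : IsCoprime n q) :
    ∑' r : Aq (star q), gchar q (star (r : GaussianInt) * n) = unitSum q := by
  obtain ⟨u, hu⟩ := isUnit_gmk_iff.2 hn
  let m : {a : GResidue q // IsUnit a} ≃ {a : GResidue q // IsUnit a} :=
    u.mulRight.subtypeEquiv fun a => by simp
  rw [unitSum, ← ((AqStarEquivUnits hq).trans m).tsum_eq]
  refine tsum_congr fun r => ?_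
  rw [← residueChar_gmk hq, map_mul, ← hu]
  rfl

/-- The terms of `unitSum (p * q)` over classes invertible modulo `q` cancel. -/
lemma sum_isCoprime_eq_zero {p q : GaussianInt} (hp : Prime p) (hq : q ≠ 0)
    [Fintype (GResidue (p * q))] :
    ∑ a : GResidue (p * q) with IsCoprime (gout (p * q) a) q, residueChar (p * q) a = 0 := by
  have hpq : p * q ≠ 0 := mul_ne_zero hp.ne_zero hq
  obtain ⟨t, ht⟩ : ∃ t, gchar (p * q) (q * t) ≠ 1 := by
    by_contra! h
    obtain ⟨c, hc⟩ := dvd_of_forall_gchar_mul_eq_one hpq h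
    exact hp.not_isUnit (.of_mul_eq_one c (mul_left_cancel₀ hq (by linear_combination -hc)))
  have hshift (a : GResidue (p * q)) :
      IsCoprime (gout (p * q) (a + gmk (p * q) (q * t))) q ↔ IsCoprime (gout (p * q) a) q := by
    have h : gmk (p * q) (gout (p * q) (a + gmk (p * q) (q * t))) =
        gmk (p * q) (gout (p * q) a + q * t) := by
      rw [map_add, gmk_gout, gmk_gout]
    obtain ⟨c, hc⟩ := gmk_eq_iff.1 h
    rw [show gout (p * q) (a + gmk (p * q) (q * t)) = gout (p * q) a + q * (t + p * c) by
      linear_combination hc]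
    exact IsCoprime.add_mul_left_left_iff
  have hsum : ∑ a : GResidue (p * q) with IsCoprime (gout (p * q) a) q, residueChar (p * q) a =
      (∑ a : GResidue (p * q) with IsCoprime (gout (p * q) a) q, residueChar (p * q) a) *
        gchar (p * q) (q * t) := by
    rw [Finset.sum_mul, Finset.sum_filter, Finset.sum_filter,
      ← Equiv.sum_comp (Equiv.addRight (gmk (p * q) (q * t)))]
    refine Finset.sum_congr rfl fun a _ => ?_
    simp only [Equiv.coe_addRight, hshift, residueChar_add hpq, residueChar_gmk hpq]
  by_contra h
  exact ht (mul_left_cancel₀ h (by rw [← hsum, mul_one]))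

lemma isUnit_iff_isCoprime_out {q : GaussianInt} (a : GResidue q) :
    IsUnit a ↔ IsCoprime (gout q a) q := by
  rw [← isUnit_gmk_iff, gmk_gout]

lemma unitSum_eq_sum (q : GaussianInt) [Fintype (GResidue q)] :
    unitSum q = ∑ a : GResidue q with IsCoprime (gout q a) q, residueChar q a := by
  rw [unitSum, tsum_fintype]
  exact (Finset.sum_subtype _ (fun a => by simp [isUnit_iff_isCoprime_out]) _).symm

lemma unitSum_prime_mul_of_dvd {p q : GaussianInt} (hp : Prime p) (hq : q ≠ 0) (h : p ∣ q) :
    unitSum (p * q) = 0 := by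
  have := finite_gResidue (mul_ne_zero hp.ne_zero hq)
  have := Fintype.ofFinite (GResidue (p * q))
  rw [unitSum_eq_sum, ← sum_isCoprime_eq_zero hp hq]
  refine Finset.sum_congr (Finset.filter_congr fun a _ => ?_) fun _ _ => rfl
  rw [IsCoprime.mul_right_iff]
  exact ⟨And.right, fun ha => ⟨ha.of_isCoprime_of_dvd_right h, ha⟩⟩

lemma unitSum_prime_mul_of_not_dvd {p q : GaussianInt} (hp : Prime p) (hq : q ≠ 0)
    (h : ¬ p ∣ q) : unitSum (p * q) = -unitSum q := by
  have hpq := mul_ne_zero hp.ne_zero hq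
  have := finite_gResidue hpq
  have := Fintype.ofFinite (GResidue (p * q))
  have := finite_gResidue hq
  have := Fintype.ofFinite (GResidue q)
  have hcop : IsCoprime p q := (hp.irreducible.coprime_iff_not_dvd).2 h
  rw [eq_neg_iff_add_eq_zero, ← sum_isCoprime_eq_zero hp hq, unitSum_eq_sum, unitSum_eq_sum,
    ← Finset.sum_filter_add_sum_filter_not
      (Finset.univ.filter fun a : GResidue (p * q) => IsCoprime (gout _ a) q)
      (fun a => IsCoprime (gout _ a) p)]
  have hout {m : GaussianInt} (y : GaussianInt) : m ∣ gout m (gmk m y) - y :=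
    gmk_eq_iff.1 (gmk_gout _)
  congr 1
  · rw [Finset.filter_filter]
    refine Finset.sum_congr (Finset.filter_congr fun a _ => ?_) fun _ _ => rfl
    rw [IsCoprime.mul_right_iff, and_comm]
  · refine Finset.sum_bij (fun b _ => gmk (p * q) (p * gout q b)) ?_ ?_ ?_ ?_
    · intro b hb
      obtain ⟨c, hc⟩ := hout (m := p * q) (p * gout q b)
      simp only [Finset.mem_filter, Finset.mem_univ, true_and] at hb ⊢
      constructor
      · rw [show gout (p * q) (gmk (p * q) (p * gout q b)) =
          p * gout q b + q * (p * c) by linear_combination hc,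
          IsCoprime.add_mul_left_left_iff]
        exact hcop.mul_left hb
      · rw [show gout (p * q) (gmk (p * q) (p * gout q b)) =
          p * (gout q b + q * c) by linear_combination hc]
        exact fun h' => hp.not_isUnit (isCoprime_self.1 h'.of_mul_left_left)
    · intro a _ b _ hab
      rw [gmk_eq_iff, ← mul_sub, mul_dvd_mul_iff_left hp.ne_zero, ← gmk_eq_iff] at hab
      simpa only [gmk_gout] using hab
    · intro a ha
      simp only [Finset.mem_filter, Finset.mem_univ, true_and] at ha
      rw [isCoprime_comm (y := p), hp.irreducible.coprime_iff_not_dvd, not_not] at ha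
      obtain ⟨h1, c, hc⟩ := ha
      obtain ⟨d, hd⟩ := hout (m := q) c
      refine ⟨gmk q c, ?_, ?_⟩
      · simp only [Finset.mem_filter, Finset.mem_univ, true_and]
        rw [← isUnit_iff_isCoprime_out, isUnit_gmk_iff]
        rw [hc] at h1
        exact h1.of_mul_left_right
      · rw [← gmk_gout a, hc]
        exact gmk_eq_iff.2 ⟨d, by linear_combination p * hd⟩
    · intro b _
      rw [residueChar_gmk hpq, gchar_mul_left hp.ne_zero, residueChar]

lemma unitSum_of_isUnit {q : GaussianInt} (hq : IsUnit q) : unitSum q = 1 := by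
  have hs : Subsingleton (GResidue q) :=
    Ideal.Quotient.subsingleton_iff.2 (Ideal.span_singleton_eq_top.2 hq)
  have h0 : IsUnit (0 : GResidue q) := by
    rw [Subsingleton.elim (0 : GResidue q) 1]
    exact isUnit_one
  rw [unitSum, tsum_eq_single ⟨0, h0⟩ fun a ha => (ha (Subtype.ext (Subsingleton.elim _ _))).elim]
  change residueChar q 0 = 1
  rw [← map_zero (gmk q), residueChar_gmk hq.ne_zero, gchar_zero]

lemma gmu_of_isUnit {q : GaussianInt} (hq : IsUnit q) : gmu q = 1 := by
  have h : UniqueFactorizationMonoid.factors q = 0 := by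
    refine Multiset.eq_zero_of_forall_notMem fun p hp => ?_
    exact (UniqueFactorizationMonoid.prime_of_factor p hp).not_isUnit
      (isUnit_of_dvd_unit (UniqueFactorizationMonoid.dvd_of_mem_factors hp) hq)
  rw [gmu, if_pos ⟨hq.ne_zero, hq.squarefree⟩, h, Multiset.card_zero, pow_zero]

lemma gmu_prime_mul_of_dvd {p q : GaussianInt} (hp : Prime p) (h : p ∣ q) :
    gmu (p * q) = 0 := by
  refine if_neg fun hs => hp.not_isUnit (hs.2 p (mul_dvd_mul_left p h))

lemma gmu_prime_mul_of_not_dvd {p q : GaussianInt} (hp : Prime p) (hq : q ≠ 0) (h : ¬ p ∣ q) :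
    gmu (p * q) = -gmu q := by
  have hcard : (UniqueFactorizationMonoid.factors (p * q)).card =
      (UniqueFactorizationMonoid.factors q).card + 1 := by
    rw [Multiset.card_eq_card_of_rel
      (UniqueFactorizationMonoid.factors_mul hp.ne_zero hq), Multiset.card_add,
      UniqueFactorizationMonoid.card_factors_of_irreducible hp.irreducible, add_comm]
  have hrel : IsRelPrime p q := hp.irreducible.isRelPrime_iff_not_dvd.2 h
  simp only [gmu, squarefree_mul_iff, hcard, hrel, hp.irreducible.squarefree, true_and, ne_eq,
    mul_eq_zero, hp.ne_zero, hq, false_or, not_false_eq_true]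
  split_ifs <;> ring

/-- The Ramanujan sum at `1` is the Möbius function. -/
lemma unitSum_eq_gmu {q : GaussianInt} (hq : q ≠ 0) : unitSum q = gmu q := by
  induction q using UniqueFactorizationMonoid.induction_on_prime with
  | h₁ => exact (hq rfl).elim
  | h₂ u hu => simp [unitSum_of_isUnit hu, gmu_of_isUnit hu]
  | h₃ q p hq' hp ih =>
    by_cases h : p ∣ q
    · simp [unitSum_prime_mul_of_dvd hp hq' h, gmu_prime_mul_of_dvd hp h]
    · simp [unitSum_prime_mul_of_not_dvd hp hq' h, gmu_prime_mul_of_not_dvd hp hq' h, ih hq']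

end GaussianSums

theorem cohen_identity (q : GaussianInt) (hq : q ≠ 0) (x : GaussianInt) :
    (∑' r : Aq (star q), gtau q (x + (r : GaussianInt))) = (gmu q : ℂ) * gtau q x := by
  have hfin {m : GaussianInt} (hm : m ≠ 0) : Finite (Aq m) :=
    ((Bq_finite hm).subset fun _ h => h.1).to_subtype
  have := hfin hq
  have := hfin (star_ne_zero.2 hq)
  have := Fintype.ofFinite (Aq q)
  have := Fintype.ofFinite (Aq (star q))
  simp only [gtau_eq_tsum_gchar, tsum_fintype, star_add, add_mul, gchar_add]
  rw [Finset.sum_comm, Finset.mul_sum]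
  refine Finset.sum_congr rfl fun n _ => ?_
  rw [← Finset.mul_sum, ← tsum_fintype (L := .unconditional _),
    tsum_gchar_star_mul hq (mem_Aq_iff.1 n.2).2, unitSum_eq_gmu hq, mul_comm]

end
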